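/- Let p⃗ ∈ (1,∞]^m with p ∈ (1/m,∞), where 1/p = Σ_{j=1}^m 1/p_j, let w⃗ ∈ A_{p⃗}, and set v_j := w_j^{-p_j'}. Then there is a constant c, depending only on d, m and p⃗, such that min_{j∈{1,…,m}} [v_j]_FW^{1/p} ≤ c · [w⃗]_{p⃗}^{min(p_1'/p, …, p_m'/p)}. -/

import Mathlib

open MeasureTheory ENNReal Set

noncomputable section

namespace Paper

variable {d m : ℕ}

abbrev Rd (d : ℕ) := Fin d → ℝ

structure Cube (d : ℕ) where
  corner : Rd d
  side : ℝ
  side_pos : 0 < side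

def Cube.set (Q : Cube d) : Set (Rd d) :=
  {x | ∀ i, Q.corner i ≤ x i ∧ x i < Q.corner i + Q.side}

/-- the average `⟨f⟩_{q,Q}` for finite exponent `q`, of an `ℝ≥0∞`-valued function -/
def eAvg (f : Rd d → ℝ≥0∞) (q : ℝ) (Q : Cube d) : ℝ≥0∞ :=
  ((volume Q.set)⁻¹ * ∫⁻ x in Q.set, f x ^ q) ^ (1 / q)

def ofFn (f : Rd d → ℝ) : Rd d → ℝ≥0∞ := fun x => ENNReal.ofReal |f x|

/-- the average `⟨f⟩_{q,Q}` for finite exponent `q > 0` -/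
def avg (f : Rd d → ℝ) (q : ℝ) (Q : Cube d) : ℝ≥0∞ := eAvg (ofFn f) q Q

/-- the average `⟨f⟩_{q,Q}` for exponent `q ∈ (0,∞]` -/
def avgE (f : Rd d → ℝ) (q : ℝ≥0∞) (Q : Cube d) : ℝ≥0∞ :=
  if q = ∞ then essSup (ofFn f) (volume.restrict Q.set) else avg f q.toReal Q

def IsWeight (u : Rd d → ℝ) : Prop :=
  MeasureTheory.LocallyIntegrable u volume ∧ ∀ᵐ x ∂(volume : Measure (Rd d)), 0 < u x

/-- `u(A) = ∫_A u dx` -/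
def wMeas (u : Rd d → ℝ) (A : Set (Rd d)) : ℝ≥0∞ := ∫⁻ x in A, ENNReal.ofReal (u x)

/-- the Hardy–Littlewood maximal operator -/
def maximal (f : Rd d → ℝ) (x : Rd d) : ℝ≥0∞ :=
  ⨆ (Q : Cube d) (_ : x ∈ Q.set), avg f 1 Q

/-- the Fujii–Wilson constant `[u]_FW` -/
def FW (u : Rd d → ℝ) : ℝ≥0∞ :=
  ⨆ Q : Cube d, (wMeas u Q.set)⁻¹ * ∫⁻ x in Q.set, maximal (Q.set.indicator u) x

/-- Hölder conjugate in `ℝ≥0∞` -/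
def conj (q : ℝ≥0∞) : ℝ≥0∞ := (1 - q⁻¹)⁻¹

def prodW (w : Fin m → Rd d → ℝ) : Rd d → ℝ := fun x => ∏ j, w j x

/-- the two-weight multilinear Muckenhoupt constant `[w⃗,ω]_{p⃗}`; here `p0` is the
real number with `1/p0 = ∑ 1/p j`. -/
def APtw (p0 : ℝ) (p : Fin m → ℝ≥0∞) (w : Fin m → Rd d → ℝ) (ω : Rd d → ℝ) : ℝ≥0∞ :=
  ⨆ Q : Cube d, avg ω p0 Q * ∏ j, avgE (fun x => (w j x)⁻¹) (conj (p j)) Q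

/-- the multilinear Muckenhoupt constant `[w⃗]_{p⃗}` -/
def AP (p0 : ℝ) (p : Fin m → ℝ≥0∞) (w : Fin m → Rd d → ℝ) : ℝ≥0∞ :=
  APtw p0 p w (prodW w)

def IsSparse (η : ℝ) (S : Set (Cube d)) : Prop :=
  ∃ E : Cube d → Set (Rd d),
    (∀ Q ∈ S, E Q ⊆ Q.set ∧ MeasurableSet (E Q) ∧
      ENNReal.ofReal η * volume Q.set ≤ volume (E Q)) ∧
    S.PairwiseDisjoint E

def dyadicGrid (d : ℕ) (α : Rd d) : Set (Cube d) :=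
  {Q | ∃ (j : ℤ) (k : Fin d → ℤ),
    Q.side = (2:ℝ) ^ (-j) ∧ ∀ i, Q.corner i = (2:ℝ) ^ (-j) * (α i + k i)}

def IsDyadicGrid (D : Set (Cube d)) : Prop :=
  ∃ α : Rd d, (∀ i, α i = 0 ∨ α i = 1/3 ∨ α i = 2/3) ∧ D = dyadicGrid d α

/-- bounded, compactly supported, measurable -/
def BCS (f : Rd d → ℝ) : Prop :=
  Measurable f ∧ (∃ C, ∀ x, |f x| ≤ C) ∧ HasCompactSupport f

def sparseForm (S : Set (Cube d)) (f : Fin m → Rd d → ℝ) (g : Rd d → ℝ) : ℝ≥0∞ :=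
  ∑' Q : S, (∏ j, avg (f j) 1 Q.1) * avg g 1 Q.1 * volume (Q.1).set

def SparseFormDom (T : (Fin m → Rd d → ℝ) → Rd d → ℝ) (CT : ℝ≥0∞) : Prop :=
  ∀ (f : Fin m → Rd d → ℝ) (g : Rd d → ℝ), (∀ j, BCS (f j)) → BCS g →
    ∃ S : Set (Cube d), IsSparse (1/2) S ∧
      (∫⁻ x, ofFn (T f) x * ofFn g x) ≤ CT * sparseForm S f g

/-- `‖f‖_{L^{p,∞}_u} = sup_{λ>0} λ (u^p({f > λ}))^{1/p}` for `ℝ≥0∞`-valued `f` -/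
def eWeakNorm (u : Rd d → ℝ) (p : ℝ) (f : Rd d → ℝ≥0∞) : ℝ≥0∞ :=
  ⨆ (l : ℝ) (_ : 0 < l), ENNReal.ofReal l *
    (∫⁻ x in {x | ENNReal.ofReal l < f x}, ENNReal.ofReal (u x) ^ p) ^ (1/p)

def weakNorm (u : Rd d → ℝ) (p : ℝ) (f : Rd d → ℝ) : ℝ≥0∞ := eWeakNorm u p (ofFn f)

/-- `‖f‖_{L^p_u} = ‖fu‖_{L^p}` -/
def LpW (u : Rd d → ℝ) (p : ℝ≥0∞) (f : Rd d → ℝ) : ℝ≥0∞ :=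
  eLpNorm (fun x => f x * u x) p volume

/-- `v_j := w_j^{-p_j'}` -/
def vW (p : Fin m → ℝ≥0∞) (w : Fin m → Rd d → ℝ) (j : Fin m) : Rd d → ℝ :=
  fun x => w j x ^ (-(conj (p j)).toReal)

/-- The average over a ball in the sup metric. -/
def ballAvg (f : Rd d → ℝ≥0∞) (c : Rd d) (r : ℝ) : ℝ≥0∞ :=
  (volume (Metric.closedBall c r))⁻¹ * ∫⁻ x in Metric.closedBall c r, f x

/-- The uncentered maximal function over balls of radius at most `S`. -/
def truncMax (S : ℝ) (f : Rd d → ℝ≥0∞) (x : Rd d) : ℝ≥0∞ :=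
  ⨆ (c : Rd d) (r : ℝ) (_ : 0 < r ∧ r ≤ S ∧ x ∈ Metric.ball c r), ballAvg f c r

lemma lt_truncMax_iff {S : ℝ} {f : Rd d → ℝ≥0∞} {x : Rd d} {a : ℝ≥0∞} :
    a < truncMax S f x ↔
      ∃ c r, (0 < r ∧ r ≤ S ∧ x ∈ Metric.ball c r) ∧ a < ballAvg f c r := by
  simp only [truncMax, lt_iSup_iff, exists_prop]

lemma measurable_truncMax (S : ℝ) (f : Rd d → ℝ≥0∞) : Measurable (truncMax S f) := by
  refine measurable_of_Ioi fun a => IsOpen.measurableSet ?_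
  rw [Metric.isOpen_iff]
  intro x hx
  obtain ⟨c, r, ⟨hr, hrS, hxc⟩, ha⟩ := lt_truncMax_iff.1 hx
  obtain ⟨ε, hε, hb⟩ := Metric.isOpen_iff.1 Metric.isOpen_ball x hxc
  exact ⟨ε, hε, fun y hy => lt_truncMax_iff.2 ⟨c, r, ⟨hr, hrS, hb hy⟩, ha⟩⟩

lemma volume_closedBall_ne_zero (c : Rd d) {r : ℝ} (hr : 0 < r) :
    volume (Metric.closedBall c r) ≠ 0 :=
  (Metric.measure_closedBall_pos volume c hr).ne'

lemma volume_closedBall_mul (c : Rd d) {k r : ℝ} (hk : 0 ≤ k) (hr : 0 ≤ r) :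
    volume (Metric.closedBall c (k * r)) =
      ENNReal.ofReal k ^ d * volume (Metric.closedBall c r) := by
  rw [Real.volume_pi_closedBall _ (mul_nonneg hk hr), Real.volume_pi_closedBall _ hr,
    ← ENNReal.ofReal_pow hk, ← ENNReal.ofReal_mul (by positivity), Fintype.card_fin]
  congr 1
  ring

/-- The weak type `(1,1)` bound for the truncated maximal function. -/
lemma mul_volume_lt_truncMax_le (S : ℝ) (f : Rd d → ℝ≥0∞) (l : ℝ≥0∞) :
    l * volume {x | l < truncMax S f x} ≤ 5 ^ d * ∫⁻ x, f x := by
  let t : Set (Rd d × ℝ) := {b | (0 < b.2 ∧ b.2 ≤ S) ∧ l < ballAvg f b.1 b.2}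
  obtain ⟨u, hut, hdisj, hcov⟩ := Vitali.exists_disjoint_subfamily_covering_enlargement_closedBall
    t Prod.fst Prod.snd S (fun a ha => ha.1.2) 5 (by norm_num)
  have hcount : u.Countable := hdisj.countable_of_nonempty_interior fun b hb =>
    ⟨b.1, Metric.ball_subset_interior_closedBall (Metric.mem_ball_self (hut hb).1.1)⟩
  have hsub : {x | l < truncMax S f x} ⊆ ⋃ b ∈ u, Metric.closedBall b.1 (5 * b.2) := by
    intro x hx
    obtain ⟨c, r, ⟨hr, hrS, hxc⟩, ha⟩ := lt_truncMax_iff.1 hx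
    obtain ⟨b, hb, hcb⟩ := hcov (c, r) ⟨⟨hr, hrS⟩, ha⟩
    exact mem_biUnion hb (hcb (Metric.ball_subset_closedBall hxc))
  have hball : ∀ b : u, l * volume (Metric.closedBall b.1.1 (5 * b.1.2)) ≤
      5 ^ d * ∫⁻ x in Metric.closedBall b.1.1 b.1.2, f x := by
    intro b
    obtain ⟨⟨hr, -⟩, hl⟩ := hut b.2
    rw [volume_closedBall_mul _ (by norm_num) hr.le, ENNReal.ofReal_ofNat, mul_left_comm]
    gcongr
    rw [ballAvg, mul_comm, ← div_eq_mul_inv] at hl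
    exact ((ENNReal.lt_div_iff_mul_lt (Or.inl (volume_closedBall_ne_zero _ hr))
      (Or.inl measure_closedBall_lt_top.ne)).1 hl).le
  calc l * volume {x | l < truncMax S f x}
      ≤ l * ∑' b : u, volume (Metric.closedBall b.1.1 (5 * b.1.2)) := by
        gcongr
        exact (measure_mono hsub).trans (measure_biUnion_le _ hcount _)
    _ ≤ ∑' b : u, 5 ^ d * ∫⁻ x in Metric.closedBall b.1.1 b.1.2, f x := by
        rw [← ENNReal.tsum_mul_left]
        exact ENNReal.tsum_le_tsum hball
    _ = 5 ^ d * ∫⁻ x in ⋃ b ∈ u, Metric.closedBall b.1 b.2, f x := by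
        rw [ENNReal.tsum_mul_left, lintegral_biUnion hcount
          (fun _ _ => Metric.isClosed_closedBall.measurableSet) hdisj]
    _ ≤ 5 ^ d * ∫⁻ x, f x := by
        gcongr
        exact Measure.restrict_le_self

lemma ballAvg_le_add (f : Rd d → ℝ≥0∞) (a : ℝ≥0∞) (c : Rd d) {r : ℝ} (hr : 0 < r) :
    ballAvg f c r ≤ ballAvg ({x | a < f x}.indicator f) c r + a := by
  calc ballAvg f c r
      ≤ (volume (Metric.closedBall c r))⁻¹ *
          ∫⁻ x in Metric.closedBall c r, ({x | a < f x}.indicator f x + a) := by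
        unfold ballAvg
        gcongr with x
        by_cases hx : a < f x
        · simp [indicator, hx]
        · exact le_add_left (not_lt.1 hx)
    _ = _ := by
        rw [lintegral_add_right _ measurable_const, mul_add, lintegral_const,
          Measure.restrict_apply_univ, mul_left_comm, ENNReal.inv_mul_cancel
          (volume_closedBall_ne_zero _ hr) measure_closedBall_lt_top.ne, mul_one, ballAvg]

lemma mul_volume_lt_truncMax_le_indicator (S : ℝ) (f : Rd d → ℝ≥0∞) (l : ℝ≥0∞) :
    l * volume {x | l < truncMax S f x} ≤
      2 * 5 ^ d * ∫⁻ x, {x | l / 2 < f x}.indicator f x := by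
  have hsub : {x | l < truncMax S f x} ⊆
      {x | l / 2 < truncMax S ({x | l / 2 < f x}.indicator f) x} := by
    intro x hx
    obtain ⟨c, r, hr, ha⟩ := lt_truncMax_iff.1 hx
    refine lt_truncMax_iff.2 ⟨c, r, hr, ?_⟩
    have h := ha.trans_le (ballAvg_le_add f (l / 2) c hr.1)
    by_contra! h'
    exact h.not_ge ((add_le_add_left h' _).trans_eq (ENNReal.add_halves l))
  calc l * volume {x | l < truncMax S f x}
      = 2 * (l / 2 * volume {x | l < truncMax S f x}) := by
        rw [← mul_assoc, ENNReal.mul_div_cancel two_ne_zero ofNat_ne_top]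
    _ ≤ 2 * (5 ^ d * ∫⁻ x, {x | l / 2 < f x}.indicator f x) := by
        gcongr 2 * ?_
        exact (mul_le_mul_right (measure_mono hsub) _).trans
          (mul_volume_lt_truncMax_le S _ (l / 2))
    _ = _ := by rw [mul_assoc]

lemma sq_le_lintegral_indicator (a : ℝ≥0∞) :
    a ^ 2 ≤ 4 * ∫⁻ l in Ioi (0 : ℝ), if ENNReal.ofReal l < a then ENNReal.ofReal l else 0 := by
  have key : ∀ b : NNReal, (b : ℝ≥0∞) < a →
      (b : ℝ≥0∞) ^ 2 ≤
        4 * ∫⁻ l in Ioi (0 : ℝ), if ENNReal.ofReal l < a then ENNReal.ofReal l else 0 := by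
    intro b hb
    calc (b : ℝ≥0∞) ^ 2
        = 4 * ∫⁻ _ in Ioo ((b : ℝ) / 2) b, ENNReal.ofReal (b / 2) := by
          rw [lintegral_const, Measure.restrict_apply_univ, Real.volume_Ioo,
            ← ENNReal.ofReal_mul (by positivity), ← ENNReal.ofReal_ofNat 4,
            ← ENNReal.ofReal_mul (by positivity), ← ENNReal.ofReal_coe_nnreal,
            ← ENNReal.ofReal_pow (by positivity)]
          congr 1
          ring
      _ ≤ 4 * ∫⁻ l in Ioo ((b : ℝ) / 2) b,
            if ENNReal.ofReal l < a then ENNReal.ofReal l else 0 := by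
          gcongr 4 * ?_
          refine setLIntegral_mono' measurableSet_Ioo fun l hl => ?_
          have h : ENNReal.ofReal l < a := lt_of_le_of_lt
            ((ENNReal.ofReal_le_ofReal hl.2.le).trans_eq (ENNReal.ofReal_coe_nnreal)) hb
          rw [if_pos h]
          exact ENNReal.ofReal_le_ofReal hl.1.le
      _ ≤ _ := by
          gcongr
          exact fun l hl => lt_of_le_of_lt (by positivity) hl.1
  rcases eq_or_ne a 0 with rfl | ha
  · simp
  rw [← ENNReal.rpow_natCast, ← ENNReal.le_rpow_inv_iff (by norm_num)]
  refine ENNReal.le_of_forall_nnreal_lt fun b hb => ?_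
  rw [ENNReal.le_rpow_inv_iff (by norm_num), ENNReal.rpow_natCast]
  exact key b hb

lemma lintegral_indicator_half_lt_le (a : ℝ≥0∞) :
    ∫⁻ l in Ioi (0 : ℝ), (if ENNReal.ofReal l / 2 < a then a else 0) ≤ 2 * a ^ 2 := by
  rcases eq_or_ne a ∞ with rfl | ha
  · simp
  have hle : ∀ l ∈ Ioi (0 : ℝ), (if ENNReal.ofReal l / 2 < a then a else 0) ≤
      (Iio (2 * a.toReal)).indicator (fun _ => a) l := by
    intro l hl
    split_ifs with h
    · rw [indicator_of_mem]
      rw [ENNReal.div_lt_iff (Or.inl two_ne_zero) (Or.inl ofNat_ne_top),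
        ENNReal.ofReal_lt_iff_lt_toReal (le_of_lt hl) (by finiteness), ENNReal.toReal_mul] at h
      simpa [mul_comm] using h
    · exact zero_le
  calc _ ≤ ∫⁻ l in Ioi (0 : ℝ), (Iio (2 * a.toReal)).indicator (fun _ => a) l :=
        setLIntegral_mono' measurableSet_Ioi hle
    _ = a * ENNReal.ofReal (2 * a.toReal) := by
        rw [lintegral_indicator_const measurableSet_Iio, Measure.restrict_apply measurableSet_Iio,
          Iio_inter_Ioi, Real.volume_Ioo, sub_zero]
    _ = 2 * a ^ 2 := by
        rw [ENNReal.ofReal_mul zero_le_two, ENNReal.ofReal_toReal ha, ENNReal.ofReal_ofNat]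
        ring

/-- The strong type `(2,2)` bound for the truncated maximal function. -/
lemma lintegral_truncMax_sq_le (S : ℝ) {f : Rd d → ℝ≥0∞} (hf : Measurable f) :
    ∫⁻ x, truncMax S f x ^ 2 ≤ 16 * 5 ^ d * ∫⁻ x, f x ^ 2 := by
  have hg := measurable_truncMax S f
  calc ∫⁻ x, truncMax S f x ^ 2
      ≤ ∫⁻ x, 4 * ∫⁻ l in Ioi (0 : ℝ),
          if ENNReal.ofReal l < truncMax S f x then ENNReal.ofReal l else 0 :=
        lintegral_mono fun x => sq_le_lintegral_indicator _
    _ = 4 * ∫⁻ l in Ioi (0 : ℝ), ∫⁻ x,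
          if ENNReal.ofReal l < truncMax S f x then ENNReal.ofReal l else 0 := by
        rw [lintegral_const_mul' _ _ ofNat_ne_top, lintegral_lintegral_swap]
        exact (Measurable.ite (measurableSet_lt (by fun_prop) (by fun_prop))
          (by fun_prop) measurable_const).aemeasurable
    _ ≤ 4 * ∫⁻ l in Ioi (0 : ℝ), 2 * 5 ^ d * ∫⁻ x,
          if ENNReal.ofReal l / 2 < f x then f x else 0 := by
        gcongr with l
        convert mul_volume_lt_truncMax_le_indicator S f (ENNReal.ofReal l) using 1
        · rw [← lintegral_indicator_const (measurableSet_lt measurable_const hg)]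
          simp only [indicator_apply, mem_ofPred_eq]
        · simp only [indicator_apply, mem_ofPred_eq]
    _ = 4 * (2 * 5 ^ d * ∫⁻ x, ∫⁻ l in Ioi (0 : ℝ),
          if ENNReal.ofReal l / 2 < f x then f x else 0) := by
        rw [lintegral_const_mul' _ _ (by finiteness), lintegral_lintegral_swap]
        exact (Measurable.ite (measurableSet_lt (by fun_prop) (by fun_prop))
          (by fun_prop) measurable_const).aemeasurable
    _ ≤ 4 * (2 * 5 ^ d * ∫⁻ x, 2 * f x ^ 2) := by
        gcongr with x
        exact lintegral_indicator_half_lt_le _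
    _ = 16 * 5 ^ d * ∫⁻ x, f x ^ 2 := by
        rw [lintegral_const_mul' _ _ ofNat_ne_top]
        ring

/-- Hölder's inequality on a probability space, for functions whose product is one. -/
lemma one_le_prod_lintegral_rpow {α ι : Type*} [MeasurableSpace α] {μ : Measure α}
    [IsProbabilityMeasure μ] [Fintype ι] [Nonempty ι] {f : ι → α → ℝ≥0∞} {q : ι → ℝ}
    (hf : ∀ i, AEMeasurable (f i) μ) (hq : ∀ i, 0 < q i) (h1 : ∀ᵐ x ∂μ, ∏ i, f i x = 1) :
    1 ≤ ∏ i, (∫⁻ x, f i x ^ q i ∂μ) ^ (1 / q i) := by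
  set σ := ∑ i, 1 / q i with hσ
  have hσ0 : 0 < σ := Finset.sum_pos (fun i _ => one_div_pos.2 (hq i)) Finset.univ_nonempty
  have hold := ENNReal.lintegral_prod_norm_pow_le (μ := μ) Finset.univ
    (f := fun i x => f i x ^ q i) (fun i _ => (hf i).pow_const _) (p := fun i => 1 / q i / σ)
    (by rw [← Finset.sum_div, div_self hσ0.ne'])
    (fun i _ => (div_pos (one_div_pos.2 (hq i)) hσ0).le)
  have hone : ∫⁻ x, ∏ i, (f i x ^ q i) ^ (1 / q i / σ) ∂μ = 1 := by
    rw [lintegral_congr_ae (g := fun _ => 1), lintegral_one, measure_univ]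
    filter_upwards [h1] with x hx
    rw [← ENNReal.one_rpow (1 / σ), ← hx, ← ENNReal.prod_rpow_of_nonneg (by positivity)]
    refine Finset.prod_congr rfl fun i _ => ?_
    rw [← ENNReal.rpow_mul]
    congr 1
    have := (hq i).ne'
    field_simp
  rw [hone] at hold
  calc (1 : ℝ≥0∞) = 1 ^ σ := (ENNReal.one_rpow σ).symm
    _ ≤ (∏ i, (∫⁻ x, f i x ^ q i ∂μ) ^ (1 / q i / σ)) ^ σ := by gcongr
    _ = _ := by
      rw [← ENNReal.prod_rpow_of_nonneg hσ0.le]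
      refine Finset.prod_congr rfl fun i _ => ?_
      rw [← ENNReal.rpow_mul, div_mul_cancel₀ _ hσ0.ne']

lemma Cube.set_eq_pi (Q : Cube d) :
    Q.set = Set.pi univ fun i => Ico (Q.corner i) (Q.corner i + Q.side) := by
  ext x
  simp [Cube.set]

lemma Cube.measurableSet (Q : Cube d) : MeasurableSet Q.set := by
  rw [Q.set_eq_pi]
  exact MeasurableSet.univ_pi fun _ => measurableSet_Ico

lemma Cube.volume_set (Q : Cube d) : volume Q.set = ENNReal.ofReal Q.side ^ d := by
  rw [Q.set_eq_pi, Real.volume_pi_Ico]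
  simp

lemma Cube.volume_ne_zero (Q : Cube d) : volume Q.set ≠ 0 := by
  rw [Q.volume_set]
  exact pow_ne_zero _ (by simpa using Q.side_pos)

lemma Cube.volume_ne_top (Q : Cube d) : volume Q.set ≠ ∞ := by
  rw [Q.volume_set]
  finiteness

/-- Every cube that meets `Q` has its trace on `Q` inside a no larger subcube of `Q`. -/
lemma Cube.exists_subset_of_mem (Q R : Cube d) {x : Rd d} (hQ : x ∈ Q.set) (hR : x ∈ R.set) :
    ∃ P : Cube d, P.set ⊆ Q.set ∧ R.set ∩ Q.set ⊆ P.set ∧ P.side ≤ Q.side ∧ P.side ≤ R.side := by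
  refine ⟨⟨fun i => max (Q.corner i) (min (R.corner i) (Q.corner i + Q.side - min Q.side R.side)),
    min Q.side R.side, lt_min Q.side_pos R.side_pos⟩, ?_, ?_, min_le_left _ _, min_le_right _ _⟩
  · intro y hy i
    obtain ⟨h1, h2⟩ := hy i
    grind
  · rintro y ⟨hyR, hyQ⟩ i
    obtain ⟨h1, h2⟩ := hyR i
    obtain ⟨h3, h4⟩ := hyQ i
    have := hQ i
    have := hR i
    grind

lemma Cube.setLIntegral_le_truncMax (P : Cube d) (f : Rd d → ℝ≥0∞) {S : ℝ} (hS : P.side ≤ S)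
    {x : Rd d} (hx : x ∈ P.set) :
    (volume P.set)⁻¹ * ∫⁻ y in P.set, f y ≤ 2 ^ d * truncMax S f x := by
  have hmem : ∀ y ∈ P.set, y ∈ Metric.ball P.corner P.side := by
    intro y hy
    rw [Metric.mem_ball, dist_pi_lt_iff P.side_pos]
    intro i
    obtain ⟨h1, h2⟩ := hy i
    rw [Real.dist_eq, abs_lt]
    constructor <;> linarith [P.side_pos]
  have hvol : volume (Metric.closedBall P.corner P.side) = 2 ^ d * volume P.set := by
    rw [Real.volume_pi_closedBall _ P.side_pos.le, P.volume_set, Fintype.card_fin, mul_pow,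
      ENNReal.ofReal_mul (by positivity), ENNReal.ofReal_pow zero_le_two,
      ENNReal.ofReal_pow P.side_pos.le, ENNReal.ofReal_ofNat]
  calc (volume P.set)⁻¹ * ∫⁻ y in P.set, f y
      ≤ (volume P.set)⁻¹ * ∫⁻ y in Metric.closedBall P.corner P.side, f y := by
        gcongr
        exact fun y hy => Metric.ball_subset_closedBall (hmem y hy)
    _ = 2 ^ d * ballAvg f P.corner P.side := by
        rw [ballAvg, hvol, ENNReal.mul_inv (by simp) (by simp), ← mul_assoc, ← mul_assoc,
          ENNReal.mul_inv_cancel (by simp) (by finiteness), one_mul]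
    _ ≤ 2 ^ d * truncMax S f x := by
        gcongr
        exact le_iSup_of_le P.corner (le_iSup_of_le P.side
          (le_iSup_of_le ⟨P.side_pos, hS, hmem x hx⟩ le_rfl))

/-- A reverse Hölder inequality `⟨u⟩_{1,P} ≤ K ⟨u⟩_{1/2,P}` on all cubes bounds the Fujii–Wilson
constant by a dimensional multiple of `K`. -/
lemma FW_le_of_avg_le {u : Rd d → ℝ} (hu : AEMeasurable u volume)
    (hpos : ∀ᵐ x ∂(volume : Measure (Rd d)), 0 < u x) {K : ℝ≥0∞}
    (hK : ∀ P : Cube d, avg u 1 P ≤ K * avg u (1 / 2) P) :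
    FW u ≤ (2 ^ d) ^ 2 * (16 * 5 ^ d) * K := by
  refine iSup_le fun Q => ?_
  obtain ⟨g, hg, hug⟩ := (hu.norm.ennreal_ofReal.pow_const (1 / 2 : ℝ)).indicator Q.measurableSet
  have hmax : ∀ x ∈ Q.set,
      maximal (Q.set.indicator u) x ≤ K * (2 ^ d) ^ 2 * truncMax Q.side g x ^ 2 := by
    intro x hxQ
    refine iSup₂_le fun R hxR => ?_
    obtain ⟨P, hPQ, hRP, hsQ, hsR⟩ := Q.exists_subset_of_mem R hxQ hxR
    have hind : ofFn (Q.set.indicator u) = Q.set.indicator (ofFn u) := by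
      ext y
      by_cases hy : y ∈ Q.set <;> simp [ofFn, hy]
    calc avg (Q.set.indicator u) 1 R
        ≤ avg u 1 P := by
          simp only [avg, eAvg, hind, div_one, ENNReal.rpow_one]
          rw [setLIntegral_indicator Q.measurableSet, P.volume_set, R.volume_set, inter_comm]
          gcongr
      _ ≤ K * avg u (1 / 2) P := hK P
      _ = K * ((volume P.set)⁻¹ * ∫⁻ y in P.set, g y) ^ 2 := by
          have : ∫⁻ y in P.set, ofFn u y ^ (1 / 2 : ℝ) = ∫⁻ y in P.set, g y := by
            refine setLIntegral_congr_fun_ae P.measurableSet ?_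
            filter_upwards [hug] with y hy hyP
            rw [← hy, indicator_of_mem (hPQ hyP)]
            rfl
          rw [avg, eAvg, this, ← ENNReal.rpow_two]
          norm_num
      _ ≤ K * (2 ^ d * truncMax Q.side g x) ^ 2 := by
          gcongr K * ?_ ^ 2
          exact P.setLIntegral_le_truncMax g hsQ (hRP ⟨hxR, hxQ⟩)
      _ = _ := by ring
  have hsq : ∫⁻ x, g x ^ 2 = wMeas u Q.set := by
    rw [wMeas, ← lintegral_indicator Q.measurableSet]
    refine lintegral_congr_ae ?_
    filter_upwards [hug, hpos] with x hx hx0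
    rw [← hx]
    by_cases hxQ : x ∈ Q.set
    · simp only [indicator_of_mem hxQ]
      rw [← ENNReal.rpow_two, ← ENNReal.rpow_mul, Real.norm_of_nonneg hx0.le]
      norm_num
    · simp [hxQ]
  calc (wMeas u Q.set)⁻¹ * ∫⁻ x in Q.set, maximal (Q.set.indicator u) x
      ≤ (wMeas u Q.set)⁻¹ * ∫⁻ x, K * (2 ^ d) ^ 2 * truncMax Q.side g x ^ 2 := by
        gcongr _ * ?_
        exact (setLIntegral_mono' Q.measurableSet hmax).trans (setLIntegral_le_lintegral _ _)
    _ ≤ (wMeas u Q.set)⁻¹ * (K * (2 ^ d) ^ 2 * (16 * 5 ^ d * wMeas u Q.set)) := by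
        rw [lintegral_const_mul _ ((measurable_truncMax _ _).pow_const 2), ← hsq]
        gcongr
        exact lintegral_truncMax_sq_le _ hg
    _ = (2 ^ d) ^ 2 * (16 * 5 ^ d) * K * ((wMeas u Q.set)⁻¹ * wMeas u Q.set) := by ring
    _ ≤ (2 ^ d) ^ 2 * (16 * 5 ^ d) * K * 1 := by
        gcongr
        exact ENNReal.inv_mul_le_one _
    _ = _ := mul_one _

lemma conj_ne_top {q : ℝ≥0∞} (hq : 1 < q) : conj q ≠ ∞ := by
  simpa [conj, tsub_eq_zero_iff_le] using hq

lemma conj_toReal_pos {q : ℝ≥0∞} (hq : 1 < q) : 0 < (conj q).toReal := by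
  refine ENNReal.toReal_pos ?_ (conj_ne_top hq)
  simp [conj]

lemma eAvg_eq_lintegral (f : Rd d → ℝ≥0∞) (q : ℝ) (Q : Cube d) :
    eAvg f q Q = (∫⁻ x, f x ^ q ∂((volume Q.set)⁻¹ • volume.restrict Q.set)) ^ (1 / q) := by
  rw [lintegral_smul_measure, smul_eq_mul, eAvg]

lemma one_le_avg_prodW_mul {p0 : ℝ} (hp0 : 0 < p0) {w : Fin m → Rd d → ℝ}
    (hw : ∀ j, IsWeight (w j)) {q : Fin m → ℝ} (hq : ∀ j, 0 < q j) (Q : Cube d) :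
    1 ≤ avg (prodW w) p0 Q * ∏ j, avg (fun x => (w j x)⁻¹) (q j) Q := by
  have hmeas : ∀ j, AEMeasurable (w j) (volume : Measure (Rd d)) :=
    fun j => (hw j).1.aestronglyMeasurable.aemeasurable
  set μ : Measure (Rd d) := (volume Q.set)⁻¹ • volume.restrict Q.set with hμ
  have hac : μ ≪ volume :=
    (Measure.smul_absolutelyContinuous).trans Measure.restrict_le_self.absolutelyContinuous
  have : IsProbabilityMeasure μ := ⟨by
    simp [hμ, ENNReal.inv_mul_cancel Q.volume_ne_zero Q.volume_ne_top]⟩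
  have h := one_le_prod_lintegral_rpow (μ := μ)
    (f := fun i : Option (Fin m) => i.elim (ofFn (prodW w)) fun j => ofFn fun x => (w j x)⁻¹)
    (q := fun i => i.elim p0 q) ?_ ?_ ?_
  · rw [Fintype.prod_option] at h
    simpa only [avg, eAvg_eq_lintegral, Option.elim] using h
  · have hprod : AEMeasurable (prodW w) (volume : Measure (Rd d)) :=
      Finset.univ.aemeasurable_fun_prod fun j _ => hmeas j
    rintro (_ | j)
    · exact (hprod.norm.ennreal_ofReal).mono_ac hac
    · exact ((hmeas j).inv.norm.ennreal_ofReal).mono_ac hac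
  · rintro (_ | j)
    exacts [hp0, hq j]
  · refine hac.ae_le ?_
    filter_upwards [ae_all_iff.2 fun j => (hw j).2] with x hx
    have hx' : ∏ j, w j x ≠ 0 := Finset.prod_ne_zero_iff.2 fun j _ => (hx j).ne'
    simp only [Fintype.prod_option, Option.elim, ofFn]
    rw [← ENNReal.ofReal_prod_of_nonneg fun _ _ => abs_nonneg _,
      ← ENNReal.ofReal_mul (abs_nonneg _), ← Finset.abs_prod, ← abs_mul, prodW,
      Finset.prod_inv_distrib, mul_inv_cancel₀ hx', abs_one, ENNReal.ofReal_one]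

/-- The reverse Hölder inequality satisfied by `w_j⁻¹` for a multilinear Muckenhoupt weight. -/
lemma avg_inv_le {p : Fin m → ℝ≥0∞} (hp : ∀ j, 1 < p j) {p0 : ℝ} (hp0 : 0 < p0)
    {w : Fin m → Rd d → ℝ} (hw : ∀ j, IsWeight (w j)) (j : Fin m) {r : ℝ} (hr : 0 < r)
    (Q : Cube d) :
    avg (fun x => (w j x)⁻¹) (conj (p j)).toReal Q ≤
      AP p0 p w * avg (fun x => (w j x)⁻¹) r Q := by
  set A : Fin m → ℝ → ℝ≥0∞ := fun i s => avg (fun x => (w i x)⁻¹) s Q with hA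
  set B := ∏ i ∈ Finset.univ.erase j, A i (conj (p i)).toReal with hB
  have h1 : 1 ≤ avg (prodW w) p0 Q * (A j r * B) := by
    have h := one_le_avg_prodW_mul hp0 hw
      (q := Function.update (fun i => (conj (p i)).toReal) j r) (fun i => by
        rcases eq_or_ne i j with rfl | hi
        · simpa using hr
        · simpa [hi] using conj_toReal_pos (hp i)) Q
    rw [← Finset.mul_prod_erase _ _ (Finset.mem_univ j), Function.update_self] at h
    refine h.trans_eq ?_
    congr 2
    refine Finset.prod_congr rfl fun i hi => ?_
    rw [Function.update_of_ne (Finset.ne_of_mem_erase hi)]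
  have h2 : avg (prodW w) p0 Q * (A j (conj (p j)).toReal * B) ≤ AP p0 p w := by
    refine le_trans (le_of_eq ?_) (le_iSup _ Q)
    rw [hB, Finset.mul_prod_erase _ (fun i => A i (conj (p i)).toReal) (Finset.mem_univ j)]
    congr 1
    refine Finset.prod_congr rfl fun i _ => ?_
    rw [avgE, if_neg (conj_ne_top (hp i))]
  calc A j (conj (p j)).toReal
      ≤ A j (conj (p j)).toReal * (avg (prodW w) p0 Q * (A j r * B)) := le_mul_of_one_le_right' h1
    _ = avg (prodW w) p0 Q * (A j (conj (p j)).toReal * B) * A j r := by ring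
    _ ≤ AP p0 p w * A j r := by gcongr

lemma avg_rpow_neg {u : Rd d → ℝ} (hu : ∀ᵐ x ∂(volume : Measure (Rd d)), 0 < u x) {s t : ℝ}
    (hs : 0 < s) (Q : Cube d) :
    avg (fun x => u x ^ (-s)) t Q = avg (fun x => (u x)⁻¹) (s * t) Q ^ s := by
  rw [avg, avg, eAvg, eAvg, ← ENNReal.rpow_mul]
  congr 1
  · congr 1
    refine lintegral_congr_ae (ae_restrict_of_ae ?_)
    filter_upwards [hu] with x hx
    rw [ofFn, ofFn, ENNReal.rpow_mul, abs_of_pos (Real.rpow_pos_of_pos hx _),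
      abs_of_pos (inv_pos.2 hx), ENNReal.ofReal_rpow_of_pos (inv_pos.2 hx), Real.rpow_neg hx.le,
      Real.inv_rpow hx.le]
  · field_simp

/-- For a multilinear Muckenhoupt weight, each `v_j` satisfies `[v_j]_FW ≲ [w⃗]^{p_j'}`. -/
lemma FW_vW_le {p : Fin m → ℝ≥0∞} (hp : ∀ j, 1 < p j) {p0 : ℝ} (hp0 : 0 < p0)
    {w : Fin m → Rd d → ℝ} (hw : ∀ j, IsWeight (w j)) (j : Fin m) :
    FW (vW p w j) ≤ (2 ^ d) ^ 2 * (16 * 5 ^ d) * AP p0 p w ^ (conj (p j)).toReal := by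
  have hs := conj_toReal_pos (hp j)
  refine FW_le_of_avg_le ((hw j).1.aestronglyMeasurable.aemeasurable.pow_const _) ?_ fun P => ?_
  · filter_upwards [(hw j).2] with x hx
    exact Real.rpow_pos_of_pos hx _
  · rw [avg_rpow_neg (hw j).2 hs, avg_rpow_neg (hw j).2 hs, mul_one,
      ← ENNReal.mul_rpow_of_nonneg _ _ hs.le]
    gcongr
    exact avg_inv_le hp hp0 hw j (by positivity) P

/-- `min_j [v_j]_FW^{1/p} ≲ [w⃗]_{p⃗}^{min_j p_j'/p}`. -/
theorem stmt16 (d m : ℕ) (hd : 1 ≤ d) (hm : 1 ≤ m)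
    (p : Fin m → ℝ≥0∞) (hp : ∀ j, 1 < p j)
    (p0 : ℝ≥0∞) (hp0gt : (m : ℝ≥0∞)⁻¹ < p0) (hp0top : p0 ≠ ∞)
    (hp0 : p0⁻¹ = ∑ j, (p j)⁻¹) :
    ∃ c : ℝ≥0∞, c ≠ ∞ ∧
      ∀ w : Fin m → Rd d → ℝ, (∀ j, IsWeight (w j)) →
        AP p0.toReal p w ≠ ∞ →
        (⨅ j, FW (vW p w j)) ^ (p0.toReal)⁻¹ ≤
          c * AP p0.toReal p w ^ (⨅ j : Fin m, (conj (p j)).toReal / p0.toReal) := by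
  have hr : 0 < p0.toReal :=
    ENNReal.toReal_pos (lt_of_le_of_lt zero_le hp0gt).ne' hp0top
  have : Nonempty (Fin m) := ⟨⟨0, hm⟩⟩
  refine ⟨((2 ^ d) ^ 2 * (16 * 5 ^ d)) ^ (p0.toReal)⁻¹,
    ENNReal.rpow_ne_top_of_nonneg (by positivity) (by finiteness), fun w hw _ => ?_⟩
  obtain ⟨j, hj⟩ := exists_eq_ciInf_of_finite (f := fun j => (conj (p j)).toReal / p0.toReal)
  rw [← hj, div_eq_mul_inv, ENNReal.rpow_mul, ← ENNReal.mul_rpow_of_nonneg _ _ (by positivity)]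
  gcongr
  exact (iInf_le _ j).trans (FW_vW_le hp hr hw j)

end Paper
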